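/- Let n ≥ 1, let l ∈ 𝒳_n, let (l_m) be a sequence in 𝒳_n converging to l, and let f be any point of the fiber pr⁻¹(l) ⊆ F_n. Then there exist a strictly increasing map φ : ℕ → ℕ and a sequence (f_j) in F_n such that pr(f_j) = l_{φ(j)} for every j and f_j converges to f in F_n. In other words, every sequence in 𝒳_n converging to l has a subsequence which is the image under pr of a sequence in F_n converging to a prescribed element of pr⁻¹(l). -/

import Mathlib

/-!
Setup: for `n ≥ 1`, a rational function of degree `n` on `ℂP¹` is represented by a
coprime pair `(a, b)` of binary forms of degree `n` in variables `x₀, x₁`.  A binary form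
of degree `n` is encoded by its coefficient vector `Fin (n+1) → ℂ`, the form being
`∑ i, a i * x₀ ^ i * x₁ ^ (n - i)`; thus the pair space is the `(2n+2)`-dimensional
complex vector space `(Fin (n+1) → ℂ) × (Fin (n+1) → ℂ)` with its standard (coefficient)
topology.  `F_n` is the space of classes `[a : b]` of coprime pairs up to simultaneous
scaling (a subspace of `ℂP^{2n+1}`, here constructed directly as the quotient of the
coprime pairs by scaling, with the quotient topology — which agrees with the subspace
topology since the projectivization map is open and the coprime locus is saturated).
`PGL(2,ℂ)` acts on `F_n` on the right by precomposition `[a : b] · g = [a ∘ g : b ∘ g]`,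
`(a ∘ g)(x) = a (x g)`; since scalar matrices act trivially on `F_n`, the orbit space
`𝒳_n = F_n / PGL(2,ℂ)` coincides with the quotient of `F_n` by the (right) action of
`GL(2,ℂ)` by substitution, which is how we construct it.  `𝒳_n` carries the quotient
topology and `pr : F_n → 𝒳_n` is the quotient map.
-/

open Filter Topology

noncomputable section

/-- Coefficient vector of a binary form of degree `n` in `x₀, x₁`. -/
abbrev Coeffs (n : ℕ) := Fin (n + 1) → ℂ

/-- Value of the binary form with coefficient vector `a` at the point `x = (x 0, x 1)`. -/
def evalForm {n : ℕ} (a : Coeffs n) (x : Fin 2 → ℂ) : ℂ :=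
  ∑ i : Fin (n + 1), a i * x 0 ^ (i : ℕ) * x 1 ^ (n - (i : ℕ))

/-- Two binary forms of degree `n` are coprime iff they have no common zero in `ℂ² \ {0}`. -/
def IsCoprimePair {n : ℕ} (a b : Coeffs n) : Prop :=
  ∀ x : Fin 2 → ℂ, x ≠ 0 → (evalForm a x ≠ 0 ∨ evalForm b x ≠ 0)

/-- The space of coprime pairs of binary forms of degree `n`
(a subspace of the `(2n+2)`-dimensional coefficient space). -/
abbrev RatRep (n : ℕ) := { v : Coeffs n × Coeffs n // IsCoprimePair v.1 v.2 }

/-- Simultaneous rescaling of a coprime pair. -/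
def scaleRel (n : ℕ) (u v : RatRep n) : Prop := ∃ c : ℂˣ, v.val = c • u.val

/-- `F_n`: the space of rational functions `[a : b]` of degree `n`, i.e. coprime pairs of
degree-`n` binary forms up to simultaneous scaling, with the quotient (= coefficient)
topology. -/
abbrev Fn (n : ℕ) := Quot (scaleRel n)

open MvPolynomial in
/-- The binary form (as a polynomial in `MvPolynomial (Fin 2) ℂ`) with coefficient
vector `a`. -/
def toPoly {n : ℕ} (a : Coeffs n) : MvPolynomial (Fin 2) ℂ :=
  ∑ i : Fin (n + 1), C (a i) * X 0 ^ (i : ℕ) * X 1 ^ (n - (i : ℕ))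

/-- The coefficient vector of (the degree-`n` homogeneous part of) a polynomial in two
variables. -/
def ofPoly (n : ℕ) (p : MvPolynomial (Fin 2) ℂ) : Coeffs n :=
  fun j => MvPolynomial.coeff (Finsupp.single 0 (j : ℕ) + Finsupp.single 1 (n - (j : ℕ))) p

/-- Right substitution action: the coefficient vector of `a ∘ g`, where
`(a ∘ g)(x) = a (x g)`, i.e. the substitution `xⱼ ↦ ∑ i, g i j * xᵢ`. -/
def compForm {n : ℕ} (a : Coeffs n) (g : Matrix (Fin 2) (Fin 2) ℂ) : Coeffs n :=
  ofPoly n (MvPolynomial.bind₁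
    (fun j => ∑ i : Fin 2, MvPolynomial.C (g i j) * MvPolynomial.X i) (toPoly a))

/-- `p` and `q` in `F_n` are related iff `q = p · g` for some `g ∈ GL(2,ℂ)`; the orbits of
this relation are exactly the orbits of the right `PGL(2,ℂ)`-action on `F_n`. -/
def glRel (n : ℕ) (p q : Fn n) : Prop :=
  ∃ (u v : RatRep n) (g : GL (Fin 2) ℂ),
    Quot.mk (scaleRel n) u = p ∧ Quot.mk (scaleRel n) v = q ∧
    v.val = (compForm u.val.1 g.val, compForm u.val.2 g.val)

/-- The moduli space `𝒳_n = F_n / PGL(2,ℂ)` with the quotient topology. -/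
abbrev Xn (n : ℕ) := Quot (glRel n)

/-- The quotient map `pr : F_n → 𝒳_n`. -/
def pr (n : ℕ) : Fn n → Xn n := Quot.mk (glRel n)

theorem evalForm_add {n : ℕ} (a b : Coeffs n) (x : Fin 2 → ℂ) :
    evalForm (a + b) x = evalForm a x + evalForm b x := by
  simp [evalForm, add_mul, Finset.sum_add_distrib]

theorem evalForm_smul {n : ℕ} (c : ℂ) (a : Coeffs n) (x : Fin 2 → ℂ) :
    evalForm (c • a) x = c * evalForm a x := by
  simp [evalForm, Finset.mul_sum, mul_assoc]

theorem evalForm_injective {n : ℕ} : Function.Injective (evalForm (n := n)) := by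
  intro a b hab
  have hp : (∑ i : Fin (n + 1), Polynomial.monomial (i : ℕ) (a i)) =
      ∑ i : Fin (n + 1), Polynomial.monomial (i : ℕ) (b i) := by
    refine Polynomial.funext fun t => ?_
    simpa [evalForm, Polynomial.eval_finsetSum] using congrFun hab ![t, 1]
  funext j
  simpa [Polynomial.finsetSum_coeff, Polynomial.coeff_monomial, Fin.val_inj] using
    congrArg (fun p => p.coeff (j : ℕ)) hp

theorem eval_toPoly {n : ℕ} (a : Coeffs n) (x : Fin 2 → ℂ) :
    MvPolynomial.eval x (toPoly a) = evalForm a x := by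
  simp [toPoly, evalForm]

theorem isHomogeneous_toPoly {n : ℕ} (a : Coeffs n) : (toPoly a).IsHomogeneous n := by
  refine MvPolynomial.IsHomogeneous.sum _ _ _ fun i _ => ?_
  have h := ((MvPolynomial.isHomogeneous_C (Fin 2) (a i)).mul
    (MvPolynomial.isHomogeneous_X_pow (R := ℂ) (0 : Fin 2) (i : ℕ))).mul
    (MvPolynomial.isHomogeneous_X_pow (R := ℂ) (1 : Fin 2) (n - (i : ℕ)))
  convert h using 1
  omega

theorem evalForm_ofPoly {n : ℕ} {p : MvPolynomial (Fin 2) ℂ} (hp : p.IsHomogeneous n)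
    (x : Fin 2 → ℂ) : evalForm (ofPoly n p) x = MvPolynomial.eval x p := by
  let e : Fin (n + 1) → (Fin 2 →₀ ℕ) := fun j =>
    Finsupp.single 0 (j : ℕ) + Finsupp.single 1 (n - (j : ℕ))
  have he : Function.Injective e := fun i j hij => by
    simpa [e, Fin.val_inj] using DFunLike.congr_fun hij 0
  have hsub : p.support ⊆ Finset.univ.image e := by
    intro d hd
    have hdeg : d 0 + d 1 = n := by
      have := hp.degree_eq_sum_deg_support hd
      simpa [Finsupp.sum, ← Finsupp.degree_apply, Finsupp.degree_eq_sum] using this.symm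
    refine Finset.mem_image.2 ⟨⟨d 0, by omega⟩, Finset.mem_univ _, ?_⟩
    ext k
    fin_cases k
    · simp [e]
    · simp [e]
      omega
  rw [MvPolynomial.eval_eq', Finset.sum_subset hsub fun d _ hd => by
    simp [MvPolynomial.notMem_support_iff.1 hd], Finset.sum_image he.injOn]
  simp [evalForm, ofPoly, e, Fin.prod_univ_two, mul_assoc]

theorem evalForm_compForm {n : ℕ} (a : Coeffs n) (g : Matrix (Fin 2) (Fin 2) ℂ)
    (x : Fin 2 → ℂ) : evalForm (compForm a g) x = evalForm a (Matrix.vecMul x g) := by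
  rw [compForm, evalForm_ofPoly, ← eval_toPoly a, MvPolynomial.eval, MvPolynomial.eval₂Hom_bind₁]
  · congr 2
    ext j
    simp [Matrix.vecMul, dotProduct, mul_comm]
  · have hl : ∀ j, (∑ i : Fin 2, MvPolynomial.C (g i j) * MvPolynomial.X i :
        MvPolynomial (Fin 2) ℂ).IsHomogeneous 1 := fun j =>
      MvPolynomial.IsHomogeneous.sum _ _ _ fun i _ => MvPolynomial.isHomogeneous_C_mul_X _ _
    simpa using (isHomogeneous_toPoly a).aeval _ hl

theorem compForm_compForm {n : ℕ} (a : Coeffs n) (g h : Matrix (Fin 2) (Fin 2) ℂ) :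
    compForm (compForm a g) h = compForm a (h * g) :=
  evalForm_injective <| funext fun x => by
    simp only [evalForm_compForm, Matrix.vecMul_vecMul]

theorem compForm_one {n : ℕ} (a : Coeffs n) : compForm a 1 = a :=
  evalForm_injective <| funext fun x => by simp [evalForm_compForm]

theorem continuous_compForm {n : ℕ} (g : Matrix (Fin 2) (Fin 2) ℂ) :
    Continuous fun a : Coeffs n => compForm a g :=
  LinearMap.continuous_of_finiteDimensional
    ({toFun := fun a : Coeffs n => compForm a g
      map_add' := fun a b => evalForm_injective <| funext fun x => by
        simp only [evalForm_compForm, evalForm_add]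
      map_smul' := fun c a => evalForm_injective <| funext fun x => by
        simp only [evalForm_compForm, evalForm_smul, RingHom.id_apply] } :
      Coeffs n →ₗ[ℂ] Coeffs n)

/-- Substitution by an invertible matrix, as a self-homeomorphism of the space of forms. -/
def compFormHomeomorph (n : ℕ) (g : GL (Fin 2) ℂ) : Coeffs n ≃ₜ Coeffs n where
  toFun a := compForm a g.val
  invFun a := compForm a g⁻¹.val
  left_inv a := by simp only [compForm_compForm, Units.inv_mul, compForm_one]
  right_inv a := by simp only [compForm_compForm, Units.mul_inv, compForm_one]
  continuous_toFun := continuous_compForm _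
  continuous_invFun := continuous_compForm _

theorem IsCoprimePair.compForm {n : ℕ} {a b : Coeffs n} (h : IsCoprimePair a b)
    (g : GL (Fin 2) ℂ) : IsCoprimePair (compForm a g.val) (compForm b g.val) := by
  intro x hx
  simp only [evalForm_compForm]
  refine h _ fun h0 => hx ?_
  simpa [Matrix.vecMul_vecMul] using congrArg (fun y => Matrix.vecMul y g⁻¹.val) h0

theorem isCoprimePair_compForm_iff {n : ℕ} {a b : Coeffs n} (g : GL (Fin 2) ℂ) :
    IsCoprimePair (compForm a g.val) (compForm b g.val) ↔ IsCoprimePair a b := by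
  refine ⟨fun h => ?_, fun h => h.compForm g⟩
  have h' := h.compForm g⁻¹
  simp only [compForm_compForm] at h'
  rwa [Units.inv_mul, compForm_one, compForm_one] at h'

theorem IsCoprimePair.smul {n : ℕ} {a b : Coeffs n} (h : IsCoprimePair a b) (c : ℂˣ) :
    IsCoprimePair (c • a) (c • b) := by
  intro x hx
  simpa [Units.smul_def, evalForm_smul] using h x hx

/-- Right substitution as a self-homeomorphism of the space of coprime pairs. -/
def ratRepComp (n : ℕ) (g : GL (Fin 2) ℂ) : RatRep n ≃ₜ RatRep n :=
  ((compFormHomeomorph n g).prodCongr (compFormHomeomorph n g)).subtype fun v =>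
    (isCoprimePair_compForm_iff (a := v.1) (b := v.2) g).symm

/-- Rescaling as a self-homeomorphism of the space of coprime pairs. -/
def ratRepSMul (n : ℕ) (c : ℂˣ) : RatRep n ≃ₜ RatRep n :=
  (Homeomorph.smul c : (Coeffs n × Coeffs n) ≃ₜ _).subtype fun v =>
    ⟨fun h => h.smul c, fun h => by simpa using h.smul c⁻¹⟩

/-- The class in `𝒳_n` of a coprime pair. -/
def ratRepClass (n : ℕ) (u : RatRep n) : Xn n := pr n (Quot.mk _ u)

theorem map_nhds_eq_of_homeomorph {X Y : Type*} [TopologicalSpace X] {q : X → Y} (e : X ≃ₜ X)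
    (he : ∀ x, q (e x) = q x) (u : X) : map q (𝓝 (e u)) = map q (𝓝 u) := by
  rw [← e.map_nhds_eq, map_map]
  exact congrArg (fun f => map f (𝓝 u)) (funext he)

theorem map_ratRepClass_nhds_congr {n : ℕ} {u v : RatRep n}
    (h : ratRepClass n u = ratRepClass n v) :
    map (ratRepClass n) (𝓝 u) = map (ratRepClass n) (𝓝 v) := by
  let F : Fn n → Filter (Xn n) := Quot.lift (fun u => map (ratRepClass n) (𝓝 u)) <| by
    rintro u v ⟨c, hc⟩
    obtain rfl : v = ratRepSMul n c u := Subtype.ext hc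
    exact (map_nhds_eq_of_homeomorph (q := ratRepClass n) _
      (fun x => congrArg (pr n) (Quot.sound ⟨c, rfl⟩).symm) u).symm
  let G : Xn n → Filter (Xn n) := Quot.lift F <| by
    rintro _ _ ⟨u, v, g, rfl, rfl, hv⟩
    obtain rfl : v = ratRepComp n g u := Subtype.ext hv
    exact (map_nhds_eq_of_homeomorph (q := ratRepClass n) _
      (fun x => (Quot.sound ⟨x, _, g, rfl, rfl, rfl⟩ : ratRepClass n x = _).symm) u).symm
  exact congrArg G h

theorem isOpenMap_ratRepClass (n : ℕ) : IsOpenMap (ratRepClass n) := by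
  intro U hU
  change IsOpen (ratRepClass n ⁻¹' (ratRepClass n '' U))
  refine isOpen_iff_mem_nhds.2 fun v hv => ?_
  obtain ⟨u, hu, huv⟩ := hv
  rw [← mem_map, ← map_ratRepClass_nhds_congr huv]
  exact image_mem_map (hU.mem_nhds hu)

theorem IsOpenMap.exists_subseq_lift {X Y : Type*} [TopologicalSpace X]
    [FirstCountableTopology X] [TopologicalSpace Y] {q : X → Y} (hq : IsOpenMap q) (x : X)
    {y : ℕ → Y} (hy : Tendsto y atTop (𝓝 (q x))) :
    ∃ φ : ℕ → ℕ, StrictMono φ ∧ ∃ z : ℕ → X,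
      (∀ j, q (z j) = y (φ j)) ∧ Tendsto z atTop (𝓝 x) := by
  obtain ⟨V, hV⟩ := (𝓝 x).exists_antitone_basis
  obtain ⟨φ, hφ, hmem⟩ := extraction_forall_of_eventually fun k =>
    hy (hq.image_mem_nhds (hV.mem k))
  choose z hzV hz using hmem
  exact ⟨φ, hφ, z, hz, hV.tendsto hzV⟩

/-- Every sequence in `𝒳_n` converging to `l` has a subsequence which is the image under
`pr` of a sequence in `F_n` converging to a prescribed element `f` of the fiber
`pr⁻¹(l)`. -/
theorem exists_subseq_lift_of_tendsto (n : ℕ) (hn : 1 ≤ n) (l : Xn n) (lm : ℕ → Xn n)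
    (hlm : Tendsto lm atTop (𝓝 l)) (f : Fn n) (hf : pr n f = l) :
    ∃ φ : ℕ → ℕ, StrictMono φ ∧ ∃ fs : ℕ → Fn n,
      (∀ j, pr n (fs j) = lm (φ j)) ∧ Tendsto fs atTop (𝓝 f) := by
  obtain ⟨u, rfl⟩ := Quot.exists_rep f
  subst hf
  obtain ⟨φ, hφ, z, hz, hzu⟩ := (isOpenMap_ratRepClass n).exists_subseq_lift u hlm
  exact ⟨φ, hφ, fun j => Quot.mk _ (z j), hz, (continuous_quot_mk.tendsto u).comp hzu⟩
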